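/- Let G be a bipartite graph with vertex classes P (players) and F (resources), let M be a maximum matching of G, let B_1, …, B_{ℓ−1} be pairwise disjoint sets of players not matched by M with B_{≤i} = B_1 ∪ ⋯ ∪ B_i, and let I ⊆ P. Let (I_1, …, I_{ℓ−1}) be a canonical decomposition of I, i.e., a partition of I into pairwise disjoint sets such that f_M(B_{≤i}, I_{≤i}) = f_M(B_{≤i}, I) = |I_{≤i}| for every i ∈ {1,…,ℓ−1}, where I_{≤i} = I_1 ∪ ⋯ ∪ I_i. Let Γ = Γ_1 ∪ ⋯ ∪ Γ_{ℓ−1} be a corresponding canonical solution, i.e., a family of pairwise vertex-disjoint directed paths in G_M such that for each i, Γ_i consists of exactly |I_i| paths from vertices of B_i to vertices of I_i. Then for every set A of players and every i ∈ {1,…,ℓ−2}, there exists a set Π of pairwise vertex-disjoint directed paths in G_M that is simultaneously an optimal solution for G_M(B_{≤i}, A ∪ I_{≤i}) and an optimal solution for G_M(B_{≤i}, A ∪ I), and that is vertex-disjoint from Γ_{i+1} ∪ ⋯ ∪ Γ_{ℓ−1}. -/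

import Mathlib

section Framework

variable {P F : Type*} [Fintype P] [Fintype F] [DecidableEq P] [DecidableEq F]

/-- A matching of the bipartite graph with edge relation `E`: a set of
player–resource pairs that are edges, no two sharing a player or a resource. -/
def IsMatching (E : P → F → Prop) (M : Finset (P × F)) : Prop :=
  (∀ e ∈ M, E e.1 e.2) ∧
  (∀ e ∈ M, ∀ e' ∈ M, e.1 = e'.1 → e = e') ∧
  (∀ e ∈ M, ∀ e' ∈ M, e.2 = e'.2 → e = e')

/-- A maximum matching of the bipartite graph with edge relation `E`. -/
def IsMaxMatching (E : P → F → Prop) (M : Finset (P × F)) : Prop :=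
  IsMatching E M ∧ ∀ M' : Finset (P × F), IsMatching E M' → M'.card ≤ M.card

/-- The directed graph `G_M`: each edge `{p, r}` of `G` is oriented from the
resource `r` to the player `p` if `{p, r} ∈ M`, and from `p` to `r` otherwise. -/
def DirAdj (E : P → F → Prop) (M : Finset (P × F)) : P ⊕ F → P ⊕ F → Prop :=
  fun x y => match x, y with
  | Sum.inl p, Sum.inr r => E p r ∧ (p, r) ∉ M
  | Sum.inr r, Sum.inl p => (p, r) ∈ M
  | _, _ => False

/-- A (simple) directed path in the digraph with adjacency `A`, recorded as
its nonempty, duplicate-free list of vertices.  A one-vertex list is a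
trivial path. -/
def IsDirPath (A : P ⊕ F → P ⊕ F → Prop) (l : List (P ⊕ F)) : Prop :=
  l ≠ [] ∧ l.Chain' A ∧ l.Nodup

/-- The path `l` starts at a player belonging to `S`. -/
def startsIn (S : Set P) (l : List (P ⊕ F)) : Prop :=
  ∃ p ∈ S, l.head? = some (Sum.inl p)

/-- The path `l` ends at a player belonging to `T`. -/
def endsIn (T : Set P) (l : List (P ⊕ F)) : Prop :=
  ∃ q ∈ T, l.getLast? = some (Sum.inl q)

/-- A feasible solution for `G_M(S,T)`: a set of pairwise vertex-disjoint
directed paths in `G_M`, each starting at a vertex of `S` and ending at a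
vertex of `T` (single-vertex paths at vertices of `S ∩ T` are allowed). -/
def Feasible (E : P → F → Prop) (M : Finset (P × F)) (S T : Set P)
    (Ps : Finset (List (P ⊕ F))) : Prop :=
  (∀ l ∈ Ps, IsDirPath (DirAdj E M) l) ∧
  (∀ l ∈ Ps, startsIn S l) ∧
  (∀ l ∈ Ps, endsIn T l) ∧
  (∀ l ∈ Ps, ∀ l' ∈ Ps, l ≠ l' → ∀ x, x ∈ l → x ∉ l')

/-- `f_M(S,T)`: the maximum number of pairwise vertex-disjoint paths in `G_M`
from `S` to `T`. -/
noncomputable def fM (E : P → F → Prop) (M : Finset (P × F)) (S T : Set P) : ℕ :=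
  sSup {n | ∃ Ps : Finset (List (P ⊕ F)), Feasible E M S T Ps ∧ Ps.card = n}

/-- The sources of a set of paths. -/
def srcOf (Ps : Finset (List (P ⊕ F))) : Set P :=
  {p | ∃ l ∈ Ps, l.head? = some (Sum.inl p)}

/-- The sinks of a set of paths. -/
def sinkOf (Ps : Finset (List (P ⊕ F))) : Set P :=
  {p | ∃ l ∈ Ps, l.getLast? = some (Sum.inl p)}

/-- The path `l` traverses the (undirected) edge `{p, r}`. -/
def usesEdge (l : List (P ⊕ F)) (p : P) (r : F) : Prop :=
  (Sum.inl p, Sum.inr r) ∈ l.zip l.tail ∨ (Sum.inr r, Sum.inl p) ∈ l.zip l.tail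

open Classical in
/-- `M ⊕ Ps`: the symmetric difference of the matching `M` with the set of
(undirected) edges used by the paths of `Ps`. -/
noncomputable def symmDiffMatch (M : Finset (P × F)) (Ps : Finset (List (P ⊕ F))) :
    Finset (P × F) :=
  Finset.univ.filter (fun e : P × F => (∃ l ∈ Ps, usesEdge l e.1 e.2) ↔ e ∉ M)

end Framework

section Menger

open Relation

variable {V : Type*}

/-- There is a directed walk from `a` to `b` all of whose vertices lie in `W`. -/
def WalkIn (r : V → V → Prop) (W : Set V) (a b : V) : Prop :=
  a ∈ W ∧ ReflTransGen (fun u v => r u v ∧ u ∈ W ∧ v ∈ W) a b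

/-- The sets `W i` are pairwise disjoint and each carries a walk from `S` to `T`. -/
def IsLinkage {ι : Type*} (r : V → V → Prop) (S T : Set V) (W : ι → Set V) : Prop :=
  (∀ i j, i ≠ j → Disjoint (W i) (W j)) ∧ ∀ i, ∃ s ∈ S, ∃ t ∈ T, WalkIn r (W i) s t

/-- Every walk from `S` to `T` meets `X`. -/
def Separates (r : V → V → Prop) (S T X : Set V) : Prop :=
  ∀ s ∈ S, ∀ t ∈ T, ¬ WalkIn r Xᶜ s t

namespace WalkIn

variable {r r' : V → V → Prop} {W W' : Set V} {a b c : V}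

lemma left_mem (h : WalkIn r W a b) : a ∈ W := h.1

lemma right_mem (h : WalkIn r W a b) : b ∈ W := by
  obtain ⟨ha, h⟩ := h
  induction h with
  | refl => exact ha
  | tail _ h _ => exact h.2.2

lemma refl (h : a ∈ W) : WalkIn r W a a := ⟨h, .refl⟩

lemma trans (h : WalkIn r W a b) (h' : WalkIn r W b c) : WalkIn r W a c :=
  ⟨h.1, h.2.trans h'.2⟩

lemma snoc (h : WalkIn r W a b) (hr : r b c) (hc : c ∈ W) : WalkIn r W a c :=
  ⟨h.1, h.2.tail ⟨hr, h.right_mem, hc⟩⟩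

lemma mono (hW : W ⊆ W') (h : WalkIn r W a b) : WalkIn r W' a b :=
  ⟨hW h.1, ReflTransGen.mono (fun _ _ h => ⟨h.1, hW h.2.1, hW h.2.2⟩) _ _ h.2⟩

lemma mono_rel (hr : ∀ u v, r u v → r' u v) (h : WalkIn r W a b) : WalkIn r' W a b :=
  ⟨h.1, ReflTransGen.mono (fun _ _ h => ⟨hr _ _ h.1, h.2⟩) _ _ h.2⟩

lemma flip (h : WalkIn r W a b) : WalkIn (flip r) W b a :=
  ⟨h.right_mem, ReflTransGen.mono (fun _ _ h => ⟨h.1, h.2.2, h.2.1⟩) _ _ h.2.swap⟩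

lemma within_reach (h : WalkIn r W a b) : WalkIn r (W ∩ {v | WalkIn r W a v}) a b := by
  obtain ⟨ha, h⟩ := h
  induction h with
  | refl => exact refl ⟨ha, refl ha⟩
  | tail _ h ih => exact ih.snoc h.1 ⟨h.2.2, ih.right_mem.2.snoc h.1 h.2.2⟩

/-- Truncating a walk at its first vertex in `X`; only edges leaving a vertex outside `X`
are used. -/
lemma first_hit (X : Set V) (hr : ∀ u v, u ∉ X → r u v → r' u v) (h : WalkIn r W a b) :
    WalkIn r' (W \ X) a b ∨
      ∃ x ∈ X, x ∈ W ∧ WalkIn r' (insert x (W ∩ {v | WalkIn r' (W \ X) a v})) a x := by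
  obtain ⟨ha, h⟩ := h
  induction h with
  | refl =>
    by_cases hx : a ∈ X
    · exact .inr ⟨a, hx, ha, refl (Set.mem_insert _ _)⟩
    · exact .inl (refl ⟨ha, hx⟩)
  | @tail u v _ h ih =>
    rcases ih with ih | ih
    · have hu := hr u v ih.right_mem.2 h.1
      by_cases hv : v ∈ X
      · refine .inr ⟨v, hv, h.2.2, ?_⟩
        refine (ih.within_reach.mono ?_).snoc hu (Set.mem_insert _ _)
        exact fun w hw => Set.mem_insert_of_mem _ ⟨hw.1.1, hw.2⟩
      · exact .inl (ih.snoc hu ⟨h.2.2, hv⟩)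
    · exact .inr ih

end WalkIn

variable {r r' : V → V → Prop} {S T : Set V}

lemma IsLinkage.flip {ι : Type*} {W : ι → Set V} (h : IsLinkage r S T W) :
    IsLinkage (flip r) T S W :=
  ⟨h.1, fun i => by
    obtain ⟨s, hs, t, ht, hw⟩ := h.2 i
    exact ⟨t, ht, s, hs, hw.flip⟩⟩

lemma Separates.flip {X : Set V} (h : Separates r S T X) : Separates (flip r) T S X :=
  fun t ht s hs hw => h s hs t ht hw.flip

/-- A linkage with at least as many walks as a separator `X` can be truncated so as to reach
each vertex of `X` exactly once, staying before that on the source side of `X`. -/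
lemma IsLinkage.truncate {ι : Type*} [Fintype ι] {W : ι → Set V} (h : IsLinkage r S T W)
    {X : Finset V} (hX : Separates r S T X) (hcard : X.card ≤ Fintype.card ι) :
    ∃ U : V → Set V, (∀ x ∈ X, ∀ y ∈ X, x ≠ y → Disjoint (U x) (U y)) ∧
      ∀ x ∈ X, (∃ s ∈ S, WalkIn r (U x) s x) ∧ (∃ i, U x ⊆ W i) ∧
        U x ⊆ insert x {v | ∃ s ∈ S, WalkIn r (X : Set V)ᶜ s v} := by
  classical
  have key : ∀ i, ∃ x ∈ X, x ∈ W i ∧ ∃ s ∈ S, WalkIn r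
      (insert x (W i ∩ {v | WalkIn r (W i \ X) s v})) s x := by
    intro i
    obtain ⟨s, hs, t, ht, hw⟩ := h.2 i
    rcases hw.first_hit (r' := r) (X : Set V) (fun _ _ _ h => h) with h' | ⟨x, hx, hxW, h'⟩
    · exact absurd (h'.mono fun _ h => h.2) (hX s hs t ht)
    · exact ⟨x, hx, hxW, s, hs, h'⟩
  choose f hfX hfW s hs hw using key
  have hinj : Function.Injective f := by
    intro i j hij
    by_contra hne
    exact Set.disjoint_left.1 (h.1 i j hne) (hfW i) (hij ▸ hfW j)
  have himg : Finset.univ.image f = X := by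
    apply Finset.eq_of_subset_of_card_le
    · intro x hx
      obtain ⟨i, -, rfl⟩ := Finset.mem_image.1 hx
      exact hfX i
    · rwa [Finset.card_image_of_injective _ hinj, Finset.card_univ]
  have hsurj : ∀ x ∈ X, ∃ i, f i = x := by
    intro x hx
    rw [← himg] at hx
    obtain ⟨i, -, hi⟩ := Finset.mem_image.1 hx
    exact ⟨i, hi⟩
  refine ⟨fun x => {v | ∃ i, f i = x ∧ v ∈ insert x (W i ∩ {v | WalkIn r (W i \ X) (s i) v})},
    ?_, ?_⟩
  · rintro x - y - hxy
    have hsub : ∀ i, insert (f i) (W i ∩ {v | WalkIn r (W i \ X) (s i) v}) ⊆ W i := fun i =>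
      Set.insert_subset (hfW i) Set.inter_subset_left
    refine Set.disjoint_left.2 ?_
    rintro v ⟨i, rfl, hv⟩ ⟨j, rfl, hv'⟩
    exact Set.disjoint_left.1 (h.1 i j fun hij => hxy (hij ▸ rfl)) (hsub i hv) (hsub j hv')
  · intro x hx
    obtain ⟨i, rfl⟩ := hsurj x hx
    refine ⟨⟨s i, hs i, (hw i).mono fun v hv => ⟨i, rfl, hv⟩⟩, ⟨i, ?_⟩, ?_⟩
    · rintro v ⟨j, hj, hv⟩
      obtain rfl := hinj hj
      exact Set.insert_subset (hfW j) Set.inter_subset_left hv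
    · rintro v ⟨j, hj, hv⟩
      obtain rfl := hinj hj
      exact hv.imp_right fun hv => ⟨s j, hs j, hv.2.mono fun _ h => h.2⟩

/-- The sink-side version of `IsLinkage.truncate`. -/
lemma IsLinkage.truncate_sink {ι : Type*} [Fintype ι] {W : ι → Set V} (h : IsLinkage r S T W)
    {X : Finset V} (hX : Separates r S T X) (hcard : X.card ≤ Fintype.card ι) :
    ∃ U : V → Set V, (∀ x ∈ X, ∀ y ∈ X, x ≠ y → Disjoint (U x) (U y)) ∧
      ∀ x ∈ X, (∃ t ∈ T, WalkIn r (U x) x t) ∧ (∃ i, U x ⊆ W i) ∧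
        U x ⊆ insert x {v | ∃ t ∈ T, WalkIn r (X : Set V)ᶜ v t} := by
  obtain ⟨U, hU, h'⟩ := h.flip.truncate hX.flip hcard
  refine ⟨U, hU, fun x hx => ?_⟩
  obtain ⟨⟨t, ht, hw⟩, hi, hsub⟩ := h' x hx
  exact ⟨⟨t, ht, hw.flip⟩, hi, fun v hv => (hsub hv).imp_right
    fun ⟨t, ht, hw⟩ => ⟨t, ht, hw.flip⟩⟩

lemma separates_right (r : V → V → Prop) (S X : Set V) : Separates r S X X :=
  fun _ _ _ ht hw => hw.right_mem ht

lemma separates_left (r : V → V → Prop) (X T : Set V) : Separates r X T X :=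
  fun _ hs _ _ hw => hw.left_mem hs

/-- Two linkages through `Z` and the ends of an edge `(x, y)`, one on each side of a separator
`Z` of the remaining digraph, can be glued to a single linkage. -/
lemma exists_isLinkage_glue [DecidableEq V] (hle : ∀ u v, r' u v → r u v) {x y : V}
    (hxy : r x y) {Z : Finset V} (hZ : Separates r' S T Z) (hx : x ∉ Z) (hy : y ∉ Z)
    {ι κ : Type*} [Fintype ι] [Fintype κ] {W : ι → Set V} {W' : κ → Set V}
    (hW : IsLinkage r' S ↑(insert x Z) W) (hW' : IsLinkage r' ↑(insert y Z) T W')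
    (hι : Z.card + 1 ≤ Fintype.card ι) (hκ : Z.card + 1 ≤ Fintype.card κ) :
    ∃ Q : Option Z → Set V, IsLinkage r S T Q := by
  obtain ⟨U, hU, hU'⟩ := hW.truncate (separates_right _ _ _)
    (by rwa [Finset.card_insert_of_notMem hx])
  obtain ⟨D, hD, hD'⟩ := hW'.truncate_sink (separates_left _ _ _)
    (by rwa [Finset.card_insert_of_notMem hy])
  set R : Set V := {v | ∃ s ∈ S, WalkIn r' (Z : Set V)ᶜ s v}
  set C : Set V := {v | ∃ t ∈ T, WalkIn r' (Z : Set V)ᶜ v t}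
  have hRC : ∀ v ∈ R, v ∉ C := fun v ⟨s, hs, h⟩ ⟨t, ht, h'⟩ => hZ s hs t ht (h.trans h')
  have hRZ : ∀ v ∈ R, v ∉ Z := fun v ⟨s, hs, h⟩ => by simpa using h.right_mem
  have hCZ : ∀ v ∈ C, v ∉ Z := fun v ⟨s, hs, h⟩ => by simpa using h.left_mem
  have hUR : ∀ z ∈ insert x Z, U z ⊆ insert z R := fun z hz v hv =>
    ((hU' z hz).2.2 hv).imp_right fun ⟨s, hs, h⟩ => ⟨s, hs, h.mono (by
      intro w hw; simp at hw ⊢; exact hw.2)⟩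
  have hDC : ∀ z ∈ insert y Z, D z ⊆ insert z C := fun z hz v hv =>
    ((hD' z hz).2.2 hv).imp_right fun ⟨s, hs, h⟩ => ⟨s, hs, h.mono (by
      intro w hw; simp at hw ⊢; exact hw.2)⟩
  have hxmem := Finset.mem_insert_self x Z
  have hymem := Finset.mem_insert_self y Z
  have hxR : x ∈ R := by
    obtain ⟨s, hs, h⟩ := (hU' x hxmem).1
    refine ⟨s, hs, h.mono fun v hv => ?_⟩
    rcases hUR x hxmem hv with rfl | hv
    · simpa using hx
    · simpa using hRZ v hv
  have hyC : y ∈ C := by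
    obtain ⟨t, ht, h⟩ := (hD' y hymem).1
    refine ⟨t, ht, h.mono fun v hv => ?_⟩
    rcases hDC y hymem hv with rfl | hv
    · simpa using hy
    · simpa using hCZ v hv
  have hUx : U x ⊆ R := (hUR x hxmem).trans (Set.insert_subset hxR subset_rfl)
  have hDy : D y ⊆ C := (hDC y hymem).trans (Set.insert_subset hyC subset_rfl)
  have hins : ∀ (w : V) (z : Z), z.1 ∈ insert w Z := fun w z => Finset.mem_insert_of_mem z.2
  have hne : ∀ {w : V}, w ∉ Z → ∀ z : Z, w ≠ z := fun hw z h => hw (h ▸ z.2)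
  have hUD : ∀ z z' : Z, z ≠ z' → Disjoint (U z) (D z') := by
    intro z z' hzz
    refine Set.disjoint_left.2 fun v hv hv' => ?_
    rcases hUR z (hins x z) hv with h1 | h1 <;> rcases hDC z' (hins y z') hv' with h2 | h2
    · exact hzz (Subtype.ext (h1.symm.trans h2))
    · exact hCZ v h2 (h1 ▸ z.2)
    · exact hRZ v h1 (h2 ▸ z'.2)
    · exact hRC v h1 h2
  have hUDy : ∀ z : Z, Disjoint (U z) (D y) := by
    intro z
    refine Set.disjoint_left.2 fun v hv hv' => ?_
    rcases hUR z (hins x z) hv with h1 | h1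
    · exact hCZ v (hDy hv') (h1 ▸ z.2)
    · exact hRC v h1 (hDy hv')
  have hUxD : ∀ z : Z, Disjoint (U x) (D z) := by
    intro z
    refine Set.disjoint_left.2 fun v hv hv' => ?_
    rcases hDC z (hins y z) hv' with h1 | h1
    · exact hRZ v (hUx hv) (h1 ▸ z.2)
    · exact hRC v (hUx hv) h1
  have hnone : ∀ z : Z, Disjoint (U x ∪ D y) (U z ∪ D z) := by
    intro z
    simp only [Set.disjoint_union_left, Set.disjoint_union_right]
    exact ⟨⟨hU _ hxmem _ (hins x z) (hne hx z), (hUDy z).symm⟩, hUxD z,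
      hD _ hymem _ (hins y z) (hne hy z)⟩
  refine ⟨fun o => o.elim (U x ∪ D y) (fun z => U z ∪ D z), ?_, ?_⟩
  · rintro (_ | z) (_ | z') hzz
    · exact absurd rfl hzz
    · exact hnone z'
    · exact (hnone z).symm
    · have hzz' : z ≠ z' := fun h => hzz (h ▸ rfl)
      have hzv : z.1 ≠ z'.1 := fun h => hzz' (Subtype.ext h)
      simp only [Option.elim, Set.disjoint_union_left, Set.disjoint_union_right]
      exact ⟨⟨hU _ (hins x z) _ (hins x z') hzv, (hUD z' z hzz'.symm).symm⟩, hUD z z' hzz',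
        hD _ (hins y z) _ (hins y z') hzv⟩
  · rintro (_ | z)
    · obtain ⟨s, hs, h⟩ := (hU' x hxmem).1
      obtain ⟨t, ht, h'⟩ := (hD' y hymem).1
      refine ⟨s, hs, t, ht, ?_⟩
      have h1 := (h.mono_rel hle).mono (Set.subset_union_left (t := D y))
      have h2 := (h'.mono_rel hle).mono (Set.subset_union_right (s := U x))
      exact (h1.snoc hxy h2.left_mem).trans h2
    · obtain ⟨s, hs, h⟩ := (hU' z (hins x z)).1
      obtain ⟨t, ht, h'⟩ := (hD' z (hins y z)).1
      exact ⟨s, hs, t, ht, ((h.mono_rel hle).mono Set.subset_union_left).trans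
        ((h'.mono_rel hle).mono Set.subset_union_right)⟩

/-- **Menger's theorem** for finite digraphs and disjoint walks between vertex sets. -/
theorem exists_isLinkage_of_separates_card [Finite V] [DecidableEq V] (n : ℕ)
    (r : V → V → Prop) (S T : Set V)
    (h : ∀ X : Finset V, Separates r S T X → n ≤ X.card) :
    ∃ W : Fin n → Set V, IsLinkage r S T W := by
  classical
  induction hm : {e : V × V | r e.1 e.2}.ncard using Nat.strong_induction_on generalizing r S T with
  | _ m ih =>
  subst hm
  by_cases hedge : ∃ x y, r x y
  · obtain ⟨x, y, hxy⟩ := hedge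
    set r' : V → V → Prop := fun u v => r u v ∧ ¬ (u = x ∧ v = y)
    have hle : ∀ u v, r' u v → r u v := fun _ _ h => h.1
    have hlt : {e : V × V | r' e.1 e.2}.ncard < {e : V × V | r e.1 e.2}.ncard := by
      refine Set.ncard_lt_ncard ⟨fun e he => he.1, fun hsub => ?_⟩ (Set.toFinite _)
      exact (hsub (show (x, y) ∈ {e : V × V | r e.1 e.2} from hxy)).2 ⟨rfl, rfl⟩
    by_cases hZ : ∃ Z : Finset V, Separates r' S T Z ∧ Z.card < n
    · obtain ⟨Z, hZ, hZn⟩ := hZ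
      have hleave : ∀ u v, u ∉ (↑(insert x Z) : Set V) → r u v → r' u v := fun u v hu h =>
        ⟨h, fun h' => hu (by simp [h'.1])⟩
      have henter : ∀ u v, u ∉ (↑(insert y Z) : Set V) → flip r u v → flip r' u v :=
        fun u v hu h => ⟨h, fun h' => hu (by simp [h'.2])⟩
      have hsub : ∀ (w : V) (W : Set V), W \ ↑(insert w Z) ⊆ (Z : Set V)ᶜ := fun w W v hv => by
        have := hv.2; simp at this ⊢; exact this.2
      have hxsep : ∀ X : Finset V, Separates r' S ↑(insert x Z) X → n ≤ X.card := by
        refine fun X hX => h X fun s hs t ht hw => ?_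
        rcases hw.first_hit _ hleave with h' | ⟨z, hz, hzX, h'⟩
        · exact hZ s hs t ht (h'.mono (hsub x _))
        · exact hX s hs z hz (h'.mono (Set.insert_subset hzX Set.inter_subset_left))
      have hysep : ∀ X : Finset V, Separates r' ↑(insert y Z) T X → n ≤ X.card := by
        refine fun X hX => h X fun s hs t ht hw => ?_
        rcases hw.flip.first_hit _ henter with h' | ⟨z, hz, hzX, h'⟩
        · exact hZ s hs t ht (h'.mono (hsub y _)).flip
        · exact hX z hz t ht (h'.mono (Set.insert_subset hzX Set.inter_subset_left)).flip
      have hxn := hxsep _ (separates_right _ _ _)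
      have hyn := hysep _ (separates_left _ _ _)
      have hx : x ∉ Z := fun hx => by rw [Finset.insert_eq_of_mem hx] at hxn; omega
      have hy : y ∉ Z := fun hy => by rw [Finset.insert_eq_of_mem hy] at hyn; omega
      rw [Finset.card_insert_of_notMem hx] at hxn
      obtain ⟨W, hW⟩ := ih _ hlt r' _ _ hxsep rfl
      obtain ⟨W', hW'⟩ := ih _ hlt r' _ _ hysep rfl
      obtain ⟨Q, hQ⟩ := exists_isLinkage_glue hle hxy hZ hx hy hW hW'
        (by simpa using hZn) (by simpa using hZn)
      let e : Fin n ≃ Option Z := Fintype.equivOfCardEq (by simp; omega)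
      exact ⟨fun i => Q (e i), fun i j hij => hQ.1 _ _ (e.injective.ne hij), fun i => hQ.2 _⟩
    · push Not at hZ
      obtain ⟨W, hW⟩ := ih _ hlt r' S T hZ rfl
      refine ⟨W, hW.1, fun i => ?_⟩
      obtain ⟨s, hs, t, ht, hw⟩ := hW.2 i
      exact ⟨s, hs, t, ht, hw.mono_rel hle⟩
  · push Not at hedge
    have hfin := Set.toFinite (S ∩ T)
    have hn := h hfin.toFinset (by
      rintro s hs t ht ⟨hsX, hw⟩
      rcases hw.cases_head with rfl | ⟨_, hst, _⟩
      · exact hsX (by simpa using ⟨hs, ht⟩)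
      · exact hedge _ _ hst.1)
    obtain ⟨f⟩ : Nonempty (Fin n ↪ hfin.toFinset) :=
      Function.Embedding.nonempty_of_card_le (by simpa using hn)
    refine ⟨fun i => {(f i).1}, fun i j hij => ?_, fun i => ?_⟩
    · simpa [Subtype.ext_iff] using fun h => hij (f.injective (Subtype.ext h))
    · have := (f i).2
      rw [Set.Finite.mem_toFinset] at this
      exact ⟨_, this.1, _, this.2, .refl rfl⟩

/-- Rerouting a linkage from `S` to `A ∪ T` along a linkage `C` from `S` to `T'` that saturates a
separator of `S` and `T`, so that it avoids any set `D` which is disjoint from `C` and all of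
whose vertices reach `T` inside `D`. -/
lemma IsLinkage.reroute {ι κ : Type*} [Fintype ι] {A T' D : Set V} {W : κ → Set V}
    {C : ι → Set V} {X : Finset V} (hW : IsLinkage r S (A ∪ T) W) (hC : IsLinkage r S T' C)
    (hT : T' ⊆ T) (hX : Separates r S T X) (hcard : X.card ≤ Fintype.card ι)
    (hD : ∀ v ∈ D, ∃ t ∈ T, WalkIn r D v t) (hCD : ∀ i, Disjoint (C i) D) :
    ∃ W' : κ → Set V, IsLinkage r S (A ∪ T') W' ∧ ∀ j, Disjoint (W' j) D := by
  classical
  have hX' : Separates r S T' X := fun s hs t ht => hX s hs t (hT ht)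
  obtain ⟨U, hU, hU'⟩ := hC.truncate_sink hX' hcard
  set R : Set V := {v | ∃ s ∈ S, WalkIn r (X : Set V)ᶜ s v}
  have hxU : ∀ x ∈ X, x ∈ U x := fun x hx => by
    obtain ⟨t, _, h⟩ := (hU' x hx).1
    exact h.left_mem
  have hUD : ∀ x ∈ X, Disjoint (U x) D := fun x hx => by
    obtain ⟨i, hi⟩ := (hU' x hx).2.1
    exact (hCD i).mono_left hi
  have hRD : Disjoint R D := by
    refine Set.disjoint_left.2 ?_
    rintro v ⟨s, hs, h⟩ hv
    obtain ⟨t, ht, h'⟩ := hD v hv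
    refine hX s hs t ht (h.trans (h'.mono fun w hw hwX => ?_))
    exact Set.disjoint_left.1 (hUD w hwX) (hxU w hwX) hw
  have hRU : ∀ x ∈ X, Disjoint R (U x) := by
    refine fun x hx => Set.disjoint_left.2 ?_
    rintro v ⟨s, hs, h⟩ hv
    rcases (hU' x hx).2.2 hv with rfl | ⟨t, ht, h'⟩
    · exact h.right_mem hx
    · exact hX' s hs t ht (h.trans h')
  have key : ∀ j, (∃ s ∈ S, ∃ t ∈ A, WalkIn r (W j ∩ R) s t) ∨
      ∃ x ∈ X, x ∈ W j ∧ ∃ s ∈ S, ∃ t ∈ T', WalkIn r (W j ∩ R ∪ U x) s t := by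
    intro j
    obtain ⟨s, hs, t, ht, hw⟩ := hW.2 j
    rcases hw.first_hit (r' := r) (X : Set V) (fun _ _ _ h => h) with h' | ⟨x, hx, hxW, h'⟩
    · refine .inl ⟨s, hs, t, ?_, h'.within_reach.mono fun v hv =>
        ⟨hv.1.1, s, hs, hv.2.mono fun _ h => h.2⟩⟩
      exact ht.resolve_right fun ht => hX s hs t ht (h'.mono fun _ h => h.2)
    · obtain ⟨t', ht', h''⟩ := (hU' x hx).1
      refine .inr ⟨x, hx, hxW, s, hs, t', ht', (h'.mono ?_).trans
        (h''.mono Set.subset_union_right)⟩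
      refine Set.insert_subset (.inr (hxU x hx)) fun v hv => .inl ⟨hv.1, s, hs, ?_⟩
      exact hv.2.mono fun _ h => h.2
  have key' : ∀ j, ∃ Q : Set V, (∃ s ∈ S, ∃ t ∈ A ∪ T', WalkIn r Q s t) ∧
      ∀ v ∈ Q, (v ∈ W j ∧ v ∈ R) ∨ ∃ x ∈ X, x ∈ W j ∧ v ∈ U x := by
    intro j
    rcases key j with ⟨s, hs, t, ht, h⟩ | ⟨x, hx, hxW, s, hs, t, ht, h⟩
    · exact ⟨_, ⟨s, hs, t, .inl ht, h⟩, fun v hv => .inl hv⟩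
    · exact ⟨_, ⟨s, hs, t, .inr ht, h⟩, fun v hv => hv.imp_right fun hv => ⟨x, hx, hxW, hv⟩⟩
  choose Q hQ hQ' using key'
  refine ⟨Q, ⟨fun i j hij => Set.disjoint_left.2 fun v hv hv' => ?_, hQ⟩,
    fun j => Set.disjoint_left.2 fun v hv hvD => ?_⟩
  · have hWW := Set.disjoint_left.1 (hW.1 i j hij)
    rcases hQ' i v hv with ⟨h1, h1R⟩ | ⟨x, hx, hxW, hvx⟩ <;>
      rcases hQ' j v hv' with ⟨h2, h2R⟩ | ⟨y, hy, hyW, hvy⟩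
    · exact hWW h1 h2
    · exact Set.disjoint_left.1 (hRU y hy) h1R hvy
    · exact Set.disjoint_left.1 (hRU x hx) h2R hvx
    · by_cases hxy : x = y
      · exact hWW hxW (hxy ▸ hyW)
      · exact Set.disjoint_left.1 (hU x hx y hy hxy) hvx hvy
  · rcases hQ' j v hv with ⟨_, hR⟩ | ⟨x, hx, _, hvx⟩
    · exact Set.disjoint_left.1 hRD hR hvD
    · exact Set.disjoint_left.1 (hUD x hx) hvx hvD

/-- A walk can be shortened to a duplicate-free list of vertices. -/
lemma WalkIn.exists_nodup_list {W : Set V} {a b : V} (h : WalkIn r W a b) :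
    ∃ l : List V, l.head? = some a ∧ l.getLast? = some b ∧ l.IsChain r ∧ l.Nodup ∧
      ∀ v ∈ l, v ∈ W := by
  obtain ⟨ha, h⟩ := h
  induction h with
  | refl => exact ⟨[a], by simp [ha]⟩
  | @tail u v _ h ih =>
    obtain ⟨l, hhead, hlast, hchain, hnodup, hsub⟩ := ih
    by_cases hv : v ∈ l
    · obtain ⟨l₁, l₂, rfl⟩ := List.append_of_mem hv
      have heq : l₁ ++ v :: l₂ = (l₁ ++ [v]) ++ l₂ := by simp
      rw [heq] at hchain hnodup hsub
      refine ⟨l₁ ++ [v], ?_, by simp, hchain.left_of_append, hnodup.of_append_left,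
        fun w hw => hsub w (List.mem_append_left _ hw)⟩
      cases l₁ <;> simpa using hhead
    · refine ⟨l ++ [v], by simp [List.head?_append, hhead], by simp, ?_, ?_, ?_⟩
      · refine List.isChain_append.2 ⟨hchain, by simp, ?_⟩
        intro x hx y hy
        rw [hlast] at hx
        simp only [Option.mem_def, Option.some.injEq, List.head?_cons] at hx hy
        subst hx hy
        exact h.1
      · exact List.nodup_append.2 ⟨hnodup, by simp, by
          intro w hw w' hw' heq
          simp only [List.mem_singleton] at hw'
          exact hv (hw' ▸ heq ▸ hw)⟩
      · intro w hw
        rcases List.mem_append.1 hw with hw | hw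
        · exact hsub w hw
        · rw [List.mem_singleton.1 hw]
          exact h.2.2

/-- Every vertex of a chain has a walk inside the chain to its last vertex. -/
lemma walkIn_getLast_of_isChain {l : List V} (hl : l.IsChain r) {b : V}
    (hb : l.getLast? = some b) {v : V} (hv : v ∈ l) : WalkIn r {x | x ∈ l} v b := by
  induction l generalizing v with
  | nil => simp at hv
  | cons a l ih =>
    cases l with
    | nil =>
      simp only [List.mem_singleton] at hv
      simp only [List.getLast?_singleton, Option.some.injEq] at hb
      subst hv hb
      exact .refl (by simp)
    | cons c l =>
      have hb' : (c :: l).getLast? = some b := by simpa using hb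
      have htail : ∀ w ∈ c :: l, WalkIn r {x | x ∈ a :: c :: l} w b := fun w hw =>
        (ih hl.tail hb' hw).mono fun x hx => List.mem_cons_of_mem _ hx
      rcases List.mem_cons.1 hv with rfl | hv
      · have hvc : r v c := by
          simpa using (List.isChain_cons_cons.1 hl).1
        exact ((WalkIn.refl (by simp)).snoc hvc (by simp)).trans (htail c (by simp))
      · exact htail v hv

end Menger

section Solutions

variable {P F : Type*} {E : P → F → Prop} {M : Finset (P × F)} {S T : Set P}

lemma Feasible.isLinkage {Ps : Finset (List (P ⊕ F))} (h : Feasible E M S T Ps) :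
    IsLinkage (DirAdj E M) (Sum.inl '' S) (Sum.inl '' T)
      (fun l : Ps => {x : P ⊕ F | x ∈ l.1}) := by
  obtain ⟨hpath, hs, ht, hdisj⟩ := h
  refine ⟨fun l l' hne => Set.disjoint_left.2 fun x hx hx' =>
    hdisj l l.2 l' l'.2 (fun h => hne (Subtype.ext h)) x hx hx', fun l => ?_⟩
  obtain ⟨p, hp, hhead⟩ := hs l l.2
  obtain ⟨q, hq, hlast⟩ := ht l l.2
  exact ⟨_, ⟨p, hp, rfl⟩, _, ⟨q, hq, rfl⟩, walkIn_getLast_of_isChain (hpath l l.2).2.1 hlast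
    (List.mem_of_mem_head? hhead)⟩

lemma IsLinkage.exists_feasible {ι : Type*} [Fintype ι] {W : ι → Set (P ⊕ F)}
    (h : IsLinkage (DirAdj E M) (Sum.inl '' S) (Sum.inl '' T) W) :
    ∃ Ps : Finset (List (P ⊕ F)), Feasible E M S T Ps ∧ Ps.card = Fintype.card ι ∧
      ∀ l ∈ Ps, ∃ i, ∀ x ∈ l, x ∈ W i := by
  classical
  have key : ∀ i, ∃ l : List (P ⊕ F), IsDirPath (DirAdj E M) l ∧ startsIn S l ∧ endsIn T l ∧
      ∀ x ∈ l, x ∈ W i := by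
    intro i
    obtain ⟨_, ⟨p, hp, rfl⟩, _, ⟨q, hq, rfl⟩, hw⟩ := h.2 i
    obtain ⟨l, hhead, hlast, hchain, hnodup, hsub⟩ := hw.exists_nodup_list
    exact ⟨l, ⟨by rintro rfl; simp at hhead, hchain, hnodup⟩, ⟨p, hp, hhead⟩, ⟨q, hq, hlast⟩,
      hsub⟩
  choose f hpath hs ht hsub using key
  have hinj : Function.Injective f := by
    intro i j hij
    by_contra hne
    obtain ⟨x, hx⟩ := List.exists_mem_of_ne_nil _ (hpath i).1
    exact Set.disjoint_left.1 (h.1 i j hne) (hsub i x hx) (hsub j x (hij ▸ hx))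
  refine ⟨Finset.univ.image f, ⟨?_, ?_, ?_, ?_⟩, ?_, ?_⟩
  · simpa using hpath
  · simpa using hs
  · simpa using ht
  · simp only [Finset.mem_image, Finset.mem_univ, true_and]
    rintro _ ⟨i, rfl⟩ _ ⟨j, rfl⟩ hne x hx hx'
    exact Set.disjoint_left.1 (h.1 i j fun h => hne (h ▸ rfl)) (hsub i x hx) (hsub j x hx')
  · rw [Finset.card_image_of_injective _ hinj, Finset.card_univ]
  · simp only [Finset.mem_image, Finset.mem_univ, true_and]
    rintro _ ⟨i, rfl⟩
    exact ⟨i, hsub i⟩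

lemma Feasible.mono_right {T' : Set P} (hT : T ⊆ T') {Ps : Finset (List (P ⊕ F))}
    (h : Feasible E M S T Ps) : Feasible E M S T' Ps :=
  ⟨h.1, h.2.1, fun l hl => (h.2.2.1 l hl).imp fun _ hq => ⟨hT hq.1, hq.2⟩, h.2.2.2⟩

variable [Fintype P]

lemma Feasible.card_le {Ps : Finset (List (P ⊕ F))} (h : Feasible E M S T Ps) :
    Ps.card ≤ Fintype.card P := by
  have hs : ∀ l : Ps, ∃ p : P, l.1.head? = some (Sum.inl p) := fun l =>
    (h.2.1 l l.2).imp fun _ hp => hp.2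
  choose f hf using hs
  rw [← Fintype.card_coe]
  refine Fintype.card_le_of_injective f fun l l' hll => ?_
  by_contra hne
  refine h.2.2.2 l l.2 l' l'.2 (fun h => hne (Subtype.ext h)) (Sum.inl (f l))
    (List.mem_of_mem_head? (hf l)) ?_
  rw [hll]
  exact List.mem_of_mem_head? (hf l')

lemma bddAbove_feasible_card :
    BddAbove {n | ∃ Ps : Finset (List (P ⊕ F)), Feasible E M S T Ps ∧ Ps.card = n} := by
  refine ⟨Fintype.card P, ?_⟩
  rintro _ ⟨Ps, h, rfl⟩
  exact h.card_le

lemma Feasible.card_le_fM {Ps : Finset (List (P ⊕ F))} (h : Feasible E M S T Ps) :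
    Ps.card ≤ fM E M S T :=
  le_csSup bddAbove_feasible_card ⟨Ps, h, rfl⟩

variable (E M S T) in
lemma exists_feasible_card_eq_fM :
    ∃ Ps : Finset (List (P ⊕ F)), Feasible E M S T Ps ∧ Ps.card = fM E M S T :=
  Nat.sSup_mem (s := {n | ∃ Ps : Finset (List (P ⊕ F)), Feasible E M S T Ps ∧ Ps.card = n})
    ⟨0, ∅, by simp [Feasible], rfl⟩ bddAbove_feasible_card

variable (E M S T) in
lemma exists_separates_card_le_fM [Finite F] :
    ∃ X : Finset (P ⊕ F),
      Separates (DirAdj E M) (Sum.inl '' S) (Sum.inl '' T) X ∧ X.card ≤ fM E M S T := by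
  classical
  by_contra! hcon
  obtain ⟨W, hW⟩ := exists_isLinkage_of_separates_card (fM E M S T + 1) _ _ _ hcon
  obtain ⟨Ps, hPs, hcard, -⟩ := hW.exists_feasible
  have := hPs.card_le_fM
  rw [hcard, Fintype.card_fin] at this
  omega

end Solutions

/-- **Common optimal solution avoiding the upper parts of a canonical
solution (Lemma `common-sol`).**  Let `M` be a maximum matching, let
`B 0, …, B (k-1)` be pairwise disjoint sets of players unmatched by `M`
(these are `B_1, …, B_{ℓ−1}`), let `(Isub 0, …, Isub (k-1))` be a canonical
decomposition of `I` and let `Γ 0, …, Γ (k-1)` be a corresponding canonical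
solution.  Then for every set `A` of players and every index `i` with
`i + 1 < k` (i.e. `i ∈ {1, …, ℓ−2}`), the problems `G_M(B_{≤i}, A ∪ I_{≤i})`
and `G_M(B_{≤i}, A ∪ I)` share a common optimal solution that is
vertex-disjoint from `Γ_{i+1} ∪ ⋯ ∪ Γ_{ℓ−1}`. -/
theorem common_optimal_solution
    {P F : Type*} [Fintype P] [Fintype F] [DecidableEq P] [DecidableEq F]
    (E : P → F → Prop) (M : Finset (P × F)) (hM : IsMaxMatching E M)
    (k : ℕ) (B : Fin k → Finset P)
    (hBdisj : ∀ i j : Fin k, i ≠ j → Disjoint (B i) (B j))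
    (hBunmatched : ∀ i : Fin k, ∀ p ∈ B i, ∀ r, (p, r) ∉ M)
    (I : Finset P) (Isub : Fin k → Finset P) (Γ : Fin k → Finset (List (P ⊕ F)))
    -- `(Isub i)` is a canonical decomposition of `I`:
    (hIdisj : ∀ i j : Fin k, i ≠ j → Disjoint (Isub i) (Isub j))
    (hIunion : Finset.univ.biUnion Isub = I)
    (hcanon : ∀ i : Fin k,
      fM E M ↑((Finset.univ.filter (fun j => j ≤ i)).biUnion B)
           ↑((Finset.univ.filter (fun j => j ≤ i)).biUnion Isub)
        = fM E M ↑((Finset.univ.filter (fun j => j ≤ i)).biUnion B) ↑I ∧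
      fM E M ↑((Finset.univ.filter (fun j => j ≤ i)).biUnion B) ↑I
        = ((Finset.univ.filter (fun j => j ≤ i)).biUnion Isub).card)
    -- `Γ` is a corresponding canonical solution:
    (hΓpath : ∀ i : Fin k, ∀ l ∈ Γ i, IsDirPath (DirAdj E M) l)
    (hΓdisj : ∀ i j : Fin k, ∀ l ∈ Γ i, ∀ l' ∈ Γ j, l ≠ l' → ∀ x, x ∈ l → x ∉ l')
    (hΓfam : ∀ i j : Fin k, i ≠ j → Disjoint (Γ i) (Γ j))
    (hΓcard : ∀ i : Fin k, (Γ i).card = (Isub i).card)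
    (hΓends : ∀ i : Fin k, ∀ l ∈ Γ i, startsIn ↑(B i) l ∧ endsIn ↑(Isub i) l)
    -- the statement:
    (A : Set P) (i : Fin k) (hik : (i : ℕ) + 1 < k) :
    ∃ Ps : Finset (List (P ⊕ F)),
      Feasible E M ↑((Finset.univ.filter (fun j => j ≤ i)).biUnion B)
        (A ∪ ↑((Finset.univ.filter (fun j => j ≤ i)).biUnion Isub)) Ps ∧
      Ps.card = fM E M ↑((Finset.univ.filter (fun j => j ≤ i)).biUnion B)
        (A ∪ ↑((Finset.univ.filter (fun j => j ≤ i)).biUnion Isub)) ∧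
      Feasible E M ↑((Finset.univ.filter (fun j => j ≤ i)).biUnion B) (A ∪ ↑I) Ps ∧
      Ps.card = fM E M ↑((Finset.univ.filter (fun j => j ≤ i)).biUnion B) (A ∪ ↑I) ∧
      (∀ l ∈ Ps, ∀ j : Fin k, i < j → ∀ l' ∈ Γ j, ∀ x, x ∈ l → x ∉ l') := by
  set S : Finset P := (Finset.univ.filter (fun j => j ≤ i)).biUnion B
  set T' : Finset P := (Finset.univ.filter (fun j => j ≤ i)).biUnion Isub with hT'
  have hTsub : T' ⊆ I := by
    rw [← hIunion]
    exact Finset.biUnion_subset_biUnion_of_subset_left _ (Finset.filter_subset _ _)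
  obtain ⟨X, hX, hXcard⟩ := exists_separates_card_le_fM E M (S : Set P) (I : Set P)
  rw [(hcanon i).2] at hXcard
  set Λ : Finset (List (P ⊕ F)) := (Finset.univ.filter (fun j => j ≤ i)).biUnion Γ with hΛ
  have hΛcard : Λ.card = T'.card := by
    rw [hΛ, hT', Finset.card_biUnion fun a _ b _ hab => hΓfam a b hab,
      Finset.card_biUnion fun a _ b _ hab => hIdisj a b hab]
    exact Finset.sum_congr rfl fun j _ => hΓcard j
  have hΛmem : ∀ l ∈ Λ, ∃ j ≤ i, l ∈ Γ j := by simp [hΛ]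
  have hΛfeas : Feasible E M (S : Set P) (T' : Set P) Λ := by
    refine ⟨fun l hl => ?_, fun l hl => ?_, fun l hl => ?_, fun l hl l' hl' hne => ?_⟩
    · obtain ⟨j, -, hj⟩ := hΛmem l hl
      exact hΓpath j l hj
    · obtain ⟨j, hji, hj⟩ := hΛmem l hl
      obtain ⟨p, hp, h⟩ := (hΓends j l hj).1
      exact ⟨p, Finset.mem_biUnion.2 ⟨j, by simpa using hji, hp⟩, h⟩
    · obtain ⟨j, hji, hj⟩ := hΛmem l hl
      obtain ⟨p, hp, h⟩ := (hΓends j l hj).2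
      exact ⟨p, Finset.mem_biUnion.2 ⟨j, by simpa using hji, hp⟩, h⟩
    · obtain ⟨j, -, hj⟩ := hΛmem l hl
      obtain ⟨j', -, hj'⟩ := hΛmem l' hl'
      exact hΓdisj j j' l hj l' hj' hne
  set D : Set (P ⊕ F) := {x | ∃ j, i < j ∧ ∃ l ∈ Γ j, x ∈ l}
  have hDreach : ∀ v ∈ D, ∃ t ∈ Sum.inl '' (I : Set P), WalkIn (DirAdj E M) D v t := by
    rintro v ⟨j, hj, l, hl, hv⟩
    obtain ⟨q, hq, hlast⟩ := (hΓends j l hl).2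
    refine ⟨_, ⟨q, ?_, rfl⟩,
      (walkIn_getLast_of_isChain (hΓpath j l hl).2.1 hlast hv).mono fun x hx => ⟨j, hj, l, hl, hx⟩⟩
    rw [← hIunion]
    exact Finset.mem_biUnion.2 ⟨j, Finset.mem_univ _, hq⟩
  have hΛD : ∀ l : Λ, Disjoint {x : P ⊕ F | x ∈ l.1} D := by
    refine fun l => Set.disjoint_left.2 ?_
    rintro x hx ⟨j, hj, l', hl', hx'⟩
    obtain ⟨j', hj'i, hl⟩ := hΛmem l l.2
    refine hΓdisj j' j l hl l' hl' (fun h => ?_) x hx hx'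
    exact Finset.disjoint_left.1 (hΓfam j' j (hj'i.trans_lt hj).ne) hl (h ▸ hl')
  obtain ⟨Q, hQ, hQcard⟩ := exists_feasible_card_eq_fM E M (S : Set P) (A ∪ (I : Set P))
  have hQlink := hQ.isLinkage
  rw [Set.image_union] at hQlink
  obtain ⟨W, hW, hWD⟩ := hQlink.reroute hΛfeas.isLinkage
    (Set.image_mono (Finset.coe_subset.2 hTsub)) hX
    (by rwa [Fintype.card_coe, hΛcard]) hDreach hΛD
  rw [← Set.image_union] at hW
  obtain ⟨Ps, hPs, hPscard, hPsW⟩ := hW.exists_feasible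
  rw [Fintype.card_coe, hQcard] at hPscard
  have hmono : A ∪ (T' : Set P) ⊆ A ∪ (I : Set P) :=
    Set.union_subset_union_right _ (Finset.coe_subset.2 hTsub)
  refine ⟨Ps, hPs, hPs.card_le_fM.antisymm ?_, hPs.mono_right hmono, hPscard, ?_⟩
  · obtain ⟨R, hR, hRcard⟩ := exists_feasible_card_eq_fM E M (S : Set P) (A ∪ (T' : Set P))
    rw [← hRcard, hPscard]
    exact (hR.mono_right hmono).card_le_fM
  · intro l hl j hj l' hl' x hx hx'
    obtain ⟨a, ha⟩ := hPsW l hl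
    exact Set.disjoint_left.1 (hWD a) (ha x hx) ⟨j, hj, l', hl', hx'⟩
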